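/- arXiv:1210.1926 — 2 statements merged into one kernel-verified Lean document; each statement's English description precedes it below -/
import Mathlib

section
/- For any five distinct points of K with representative vectors v₁, …, v₅ ∈ F⁶, the subspace spanned by v₁, …, v₅ has dimension 5 (so the five points span a hyperplane of PG(5,3)), and exactly six points of K have a representative vector lying in this subspace. -/
/-- `F = GF(3)` realized as `ZMod 3`. -/
abbrev F3 := ZMod 3

/-- `PG(5,3)`: the projective space of `F³ ⁶` (projectivization of `Fin 6 → F`). -/
abbrev PG5 := Projectivization F3 (Fin 6 → F3)

/-- `v` is a representative vector of the projective point `Q`. -/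
def IsRep6 (v : Fin 6 → F3) (Q : PG5) : Prop :=
  ∃ hv : v ≠ 0, Projectivization.mk F3 v hv = Q

/-- The set `K ⊆ PG(5,3)`. -/
def Kset : Set PG5 :=
  {Q | ∃ x₀ x₁ x₂ : F3, (x₁, x₂) ≠ (0, 0) ∧
    IsRep6 ![x₀ ^ 2 + 1, x₀ * x₁, x₀ * x₂, x₁ ^ 2, x₁ * x₂, x₂ ^ 2] Q}

/-- Normalized representatives `(x₀, x₁, x₂)` of the points `[x₀ : x₁ : x₂]` of the plane off
`[1 : 0 : 0]`; the index `(a, some t)` stands for `(a, 1, t)` and `(a, none)` for `(a, 0, 1)`. -/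
def planeVec : F3 × Option F3 → F3 × F3 × F3
  | (a, some t) => (a, 1, t)
  | (a, none) => (a, 0, 1)

/-- The map `(x₀, x₁, x₂) ↦ (x₀² + 1, x₀x₁, x₀x₂, x₁², x₁x₂, x₂²)` parametrizing `Kset`. -/
def twistedVeronese (x : F3 × F3 × F3) : Fin 6 → F3 :=
  ![x.1 ^ 2 + 1, x.1 * x.2.1, x.1 * x.2.2, x.2.1 ^ 2, x.2.1 * x.2.2, x.2.2 ^ 2]

/-- The twelve vectors representing the points of `Kset`. -/
def kVec (i : F3 × Option F3) : Fin 6 → F3 := twistedVeronese (planeVec i)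

lemma kVec_ne_zero : ∀ i, kVec i ≠ 0 := by decide

lemma kVec_eq_of_smul_eq (i j : F3 × Option F3) (c : F3) (h : c • kVec j = kVec i) :
    i = j := by
  have h1 := congrFun h 1
  have h2 := congrFun h 2
  have h3 := congrFun h 3
  have h4 := congrFun h 4
  have h5 := congrFun h 5
  obtain ⟨a, _ | s⟩ := i <;> obtain ⟨b, _ | t⟩ := j <;>
    simp [kVec, twistedVeronese, planeVec] at h1 h2 h3 h4 h5 <;> grind

lemma planeVec_snd_ne_zero : ∀ i, ((planeVec i).2.1, (planeVec i).2.2) ≠ (0, 0) := by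
  decide

lemma exists_planeVec_eq : ∀ a b c : F3, (b, c) ≠ (0, 0) →
    ∃ i, planeVec i = (a, b, c) ∨ planeVec i = (-a, -b, -c) := by
  decide

/-- The number of zeros in `F3` of the polynomial `a (x² + 1) + b x + c`. -/
def quadraticZeros (a b c : F3) : ℕ :=
  (if a + c = 0 then 1 else 0) + (if b + (c - a) = 0 then 1 else 0) +
    (if (c - a) - b = 0 then 1 else 0)

lemma card_filter_eq_quadraticZeros : ∀ a b c : F3,
    (Finset.univ.filter fun x : F3 => (x ^ 2 + 1) * a + x * b + c = 0).card =
      quadraticZeros a b c := by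
  decide

lemma sum_quadraticZeros_mem : ∀ a b c d e f : F3,
    ¬(a = 0 ∧ b = 0 ∧ c = 0 ∧ d = 0 ∧ e = 0 ∧ f = 0) →
    quadraticZeros a c f + (quadraticZeros a b d + quadraticZeros a (b + c) (d + e + f) +
      quadraticZeros a (b - c) (d - e + f)) ∈ [0, 3, 6] := by
  decide +kernel

lemma card_filter_dotProduct_kVec (w : Fin 6 → F3) :
    (Finset.univ.filter fun i => kVec i ⬝ᵥ w = 0).card =
      quadraticZeros (w 0) (w 2) (w 5) + (quadraticZeros (w 0) (w 1) (w 3) +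
        quadraticZeros (w 0) (w 1 + w 2) (w 3 + w 4 + w 5) +
        quadraticZeros (w 0) (w 1 - w 2) (w 3 - w 4 + w 5)) := by
  have hsum : ∀ g : F3 → ℕ, ∑ t, g t = g 0 + g 1 + g (-1) := fun g => Fin.sum_univ_three g
  simp only [← card_filter_eq_quadraticZeros, Finset.card_filter]
  rw [Fintype.sum_prod_type_right, Fintype.sum_option,
    hsum fun t => ∑ x, if kVec (x, some t) ⬝ᵥ w = 0 then 1 else 0]
  refine congrArg₂ _ ?_ (congrArg₂ _ (congrArg₂ _ ?_ ?_) ?_) <;>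
    refine Finset.sum_congr rfl fun x _ => if_congr (Eq.congr_left ?_) rfl rfl <;>
    simp [kVec, twistedVeronese, planeVec, dotProduct, Fin.sum_univ_six] <;> ring

/-- The indices of the points of `Kset` on which a linear form vanishes. -/
def zeroIndices (φ : Module.Dual F3 (Fin 6 → F3)) : Finset (F3 × Option F3) :=
  {i | φ (kVec i) = 0}

lemma card_zeroIndices (φ : Module.Dual F3 (Fin 6 → F3)) (hφ : φ ≠ 0)
    (h : 5 ≤ (zeroIndices φ).card) : (zeroIndices φ).card = 6 := by
  let w : Fin 6 → F3 := fun i => φ (Pi.single i 1)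
  have hw : ∀ v, φ v = v ⬝ᵥ w := fun v => by
    conv_lhs => rw [pi_eq_sum_univ' v]
    simp [dotProduct, w]
  have hw0 : ¬(w 0 = 0 ∧ w 1 = 0 ∧ w 2 = 0 ∧ w 3 = 0 ∧ w 4 = 0 ∧ w 5 = 0) := fun h0 =>
    hφ (LinearMap.ext fun v => by simp [hw, dotProduct, Fin.sum_univ_six, h0])
  have hmem := sum_quadraticZeros_mem _ _ _ _ _ _ hw0
  rw [← card_filter_dotProduct_kVec] at hmem
  simp only [zeroIndices, hw] at h ⊢
  simp only [List.mem_cons, List.not_mem_nil, or_false] at hmem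
  omega

lemma mk_kVec_injective :
    Function.Injective fun i => Projectivization.mk F3 (kVec i) (kVec_ne_zero i) := by
  intro i j h
  obtain ⟨c, hc⟩ := (Projectivization.mk_eq_mk_iff' F3 _ _ _ _).1 h
  exact kVec_eq_of_smul_eq i j c hc

lemma Kset_eq_range :
    Kset = Set.range fun i => Projectivization.mk F3 (kVec i) (kVec_ne_zero i) := by
  ext Q
  constructor
  · rintro ⟨a, b, c, hbc, hv, hQ⟩
    obtain ⟨i, hi⟩ := exists_planeVec_eq a b c hbc
    have hi' : kVec i = ![a ^ 2 + 1, a * b, a * c, b ^ 2, b * c, c ^ 2] := by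
      rcases hi with hi | hi <;> simp [kVec, twistedVeronese, hi]
    refine ⟨i, ?_⟩
    simp only [hi', hQ]
  · rintro ⟨i, hi⟩
    exact ⟨(planeVec i).1, (planeVec i).2.1, (planeVec i).2.2, planeVec_snd_ne_zero i,
      kVec_ne_zero i, hi⟩

lemma isRep6_mk_iff {v w : Fin 6 → F3} (hw : w ≠ 0) :
    IsRep6 v (Projectivization.mk F3 w hw) ↔ ∃ c : F3ˣ, c • w = v := by
  constructor
  · rintro ⟨hv, h⟩
    exact (Projectivization.mk_eq_mk_iff F3 _ _ _ _).1 h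
  · rintro ⟨c, rfl⟩
    have hv : c • w ≠ 0 := (smul_ne_zero_iff_ne c).2 hw
    exact ⟨hv, (Projectivization.mk_eq_mk_iff F3 _ _ _ _).2 ⟨c, rfl⟩⟩

/-- A subspace containing five of the twelve vectors has annihilator of dimension at most one. -/
lemma finrank_dualAnnihilator_le_one (W : Submodule F3 (Fin 6 → F3))
    (S : Finset (F3 × Option F3)) (hS : S.card = 5) (hSW : ∀ i ∈ S, kVec i ∈ W) :
    Module.finrank F3 W.dualAnnihilator ≤ 1 := by
  by_contra! h
  have : Nontrivial W.dualAnnihilator := Module.nontrivial_of_finrank_pos (R := F3) (by omega)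
  obtain ⟨f, hf⟩ := exists_ne (0 : W.dualAnnihilator)
  obtain ⟨g, hfg⟩ := exists_linearIndependent_pair_of_one_lt_finrank h hf
  have hne := LinearIndependent.pair_iff.1 hfg
  have key : ∀ φ : W.dualAnnihilator, φ ≠ 0 → (zeroIndices φ.1 \ S).card = 1 := by
    intro φ hφ
    have hsub : S ⊆ zeroIndices φ.1 := fun i hi => by
      simpa [zeroIndices] using (Submodule.mem_dualAnnihilator _).1 φ.2 _ (hSW i hi)
    have h6 := card_zeroIndices φ.1 (by simpa using hφ) (hS ▸ Finset.card_le_card hsub)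
    rw [Finset.card_sdiff_of_subset hsub, h6, hS]
  have hg : g ≠ 0 := fun h0 => one_ne_zero (hne 0 1 (by simp [h0])).2
  have hadd : f + g ≠ 0 := fun h0 => one_ne_zero (hne 1 1 (by simpa using h0)).1
  have hsub : f - g ≠ 0 := fun h0 =>
    one_ne_zero (hne 1 (-1) (by simpa [← sub_eq_add_neg] using h0)).1
  have hvals : ∀ x y : F3, x = 0 ∨ y = 0 ∨ x + y = 0 ∨ x - y = 0 := by decide
  have hcover : (Finset.univ : Finset (F3 × Option F3)) ⊆
      S ∪ ((zeroIndices f.1 \ S ∪ zeroIndices g.1 \ S) ∪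
        (zeroIndices (f + g).1 \ S ∪ zeroIndices (f - g).1 \ S)) := by
    intro i _
    have := hvals (f.1 (kVec i)) (g.1 (kVec i))
    simp only [Finset.mem_union, Finset.mem_sdiff, zeroIndices, Finset.mem_filter_univ,
      Submodule.coe_add, Submodule.coe_sub, LinearMap.add_apply, LinearMap.sub_apply]
    tauto
  have h12 : (Finset.univ : Finset (F3 × Option F3)).card = 12 := by decide
  have h1 := Finset.card_le_card hcover
  have h2 := Finset.card_union_le S ((zeroIndices f.1 \ S ∪ zeroIndices g.1 \ S) ∪
        (zeroIndices (f + g).1 \ S ∪ zeroIndices (f - g).1 \ S))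
  have h3 := Finset.card_union_le (zeroIndices f.1 \ S ∪ zeroIndices g.1 \ S)
        (zeroIndices (f + g).1 \ S ∪ zeroIndices (f - g).1 \ S)
  have h4 := Finset.card_union_le (zeroIndices f.1 \ S) (zeroIndices g.1 \ S)
  have h5 := Finset.card_union_le (zeroIndices (f + g).1 \ S) (zeroIndices (f - g).1 \ S)
  rw [key _ hf, key _ hg] at h4
  rw [key _ hadd, key _ hsub] at h5
  omega

/-- For any five distinct points of `K` with representative vectors
`v₁, …, v₅ ∈ F⁶`, the subspace spanned by `v₁, …, v₅` has dimension 5 (so the five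
points span a hyperplane of `PG(5,3)`), and exactly six points of `K` have a
representative vector lying in this subspace. -/
theorem Kset_five_points_span_hyperplane :
    ∀ Q : Fin 5 → PG5, (∀ i, Q i ∈ Kset) → Function.Injective Q →
      ∀ v : Fin 5 → (Fin 6 → F3), (∀ i, IsRep6 (v i) (Q i)) →
        Module.finrank F3 (Submodule.span F3 (Set.range v)) = 5 ∧
        {R ∈ Kset | ∃ w, IsRep6 w R ∧ w ∈ Submodule.span F3 (Set.range v)}.ncard = 6 := by
  intro Q hQ hinj v hv
  rw [Kset_eq_range] at hQ ⊢
  choose σ hσ using hQ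
  have hσinj : Function.Injective σ := fun i j h => hinj (by rw [← hσ i, ← hσ j, h])
  set W := Submodule.span F3 (Set.range v) with hW
  have hrep : ∀ i w, IsRep6 w (Projectivization.mk F3 (kVec i) (kVec_ne_zero i)) →
      (w ∈ W ↔ kVec i ∈ W) := by
    intro i w h
    obtain ⟨c, rfl⟩ := (isRep6_mk_iff _).1 h
    exact W.smul_mem_iff' c
  have hmem : ∀ i ∈ Finset.univ.image σ, kVec i ∈ W := by
    intro i hi
    obtain ⟨j, -, rfl⟩ := Finset.mem_image.1 hi
    have hj := hv j
    rw [← hσ j] at hj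
    exact (hrep _ _ hj).1 (Submodule.subset_span ⟨j, rfl⟩)
  have hcard : (Finset.univ.image σ).card = 5 := by
    simp [Finset.card_image_of_injective _ hσinj]
  have hle := finrank_dualAnnihilator_le_one W _ hcard hmem
  have hsum := Subspace.finrank_add_finrank_dualAnnihilator_eq W
  have hW5 : Module.finrank F3 W ≤ 5 := finrank_range_le_card (R := F3) v
  rw [Module.finrank_fin_fun] at hsum
  have hrank : Module.finrank F3 W = 5 := by omega
  refine ⟨hrank, ?_⟩
  have : Nontrivial W.dualAnnihilator := Module.nontrivial_of_finrank_pos (R := F3) (by omega)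
  obtain ⟨⟨f, hfW⟩, hf⟩ := exists_ne (0 : W.dualAnnihilator)
  have hf0 : f ≠ 0 := by simpa using hf
  have hWf : W = LinearMap.ker f := by
    refine Submodule.eq_of_le_of_finrank_eq
      (fun x hx => (Submodule.mem_dualAnnihilator _).1 hfW x hx) ?_
    have := Module.Dual.finrank_ker_add_one_of_ne_zero hf0
    rw [Module.finrank_fin_fun] at this
    omega
  have hzero : ∀ i, i ∈ zeroIndices f ↔ kVec i ∈ W := by
    simp [zeroIndices, hWf]
  have h6 := card_zeroIndices f hf0
    (hcard ▸ Finset.card_le_card fun i hi => (hzero i).2 (hmem i hi))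
  have hset : {R ∈ Set.range fun i => Projectivization.mk F3 (kVec i) (kVec_ne_zero i) |
      ∃ w, IsRep6 w R ∧ w ∈ W} =
      (fun i => Projectivization.mk F3 (kVec i) (kVec_ne_zero i)) '' zeroIndices f := by
    ext R
    constructor
    · rintro ⟨⟨i, rfl⟩, w, hw, hwW⟩
      exact ⟨i, (hzero i).2 ((hrep i w hw).1 hwW), rfl⟩
    · rintro ⟨i, hi, rfl⟩
      exact ⟨⟨i, rfl⟩, kVec i, ⟨kVec_ne_zero i, rfl⟩, (hzero i).1 hi⟩
  rw [hset, Set.ncard_image_of_injective _ mk_kVec_injective, Set.ncard_coe_finset, h6]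
end

section
/- For each j ∈ F, the set C_j := Δ_j ∪ {P₀} (with P₀ = [(1,0,0)]) is the set of projective zeros of the quadratic form q_j(y) = y₀y₂ − y₁² − j·y₂², whose polar bilinear form is nondegenerate, and the set of internal points of the conic C_j equals Δ_{j+1}. -/
/-- `PG(2,3)`: the projective space of `F³`. -/
abbrev PG2 := Projectivization F3 (Fin 3 → F3)

/-- `v` is a representative vector of the projective point `X ∈ PG(2,3)`. -/
def IsRep3 (v : Fin 3 → F3) (X : PG2) : Prop :=
  ∃ hv : v ≠ 0, Projectivization.mk F3 v hv = X

/-- A line of `PG(2,3)`: the set of projective points of a 2-dimensional subspace of `F³`. -/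
def IsLine2 (L : Set PG2) : Prop :=
  ∃ W : Submodule F3 (Fin 3 → F3), Module.finrank F3 W = 2 ∧
    L = {X | ∃ v, IsRep3 v X ∧ v ∈ W}

/-- A conic in `PG(2,3)`: the set of projective zeros of a quadratic form `q` on `F³`
whose polar bilinear form `B(x,y) = q(x+y) − q(x) − q(y)` is nondegenerate. -/
def IsConic2 (C : Set PG2) : Prop :=
  ∃ q : QuadraticForm F3 (Fin 3 → F3),
    (∀ x : Fin 3 → F3, (∀ y, q (x + y) - q x - q y = 0) → x = 0) ∧
    C = {X | ∀ v, IsRep3 v X → q v = 0}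

/-- A line is a tangent of a conic `C` if it meets `C` in exactly one point. -/
def IsTangent2 (L C : Set PG2) : Prop :=
  IsLine2 L ∧ (L ∩ C).ncard = 1

/-- A point of `PG(2,3)` is an internal point of `C` if it lies on no tangent of `C`. -/
def IsInternal2 (X : PG2) (C : Set PG2) : Prop :=
  ∀ L : Set PG2, IsTangent2 L C → X ∉ L

/-- For `j ∈ F` the set `Δ_j := { [(u²+j, u, 1)] : u ∈ F } ⊆ PG(2,3)`. -/
def Δ2 (j : F3) : Set PG2 :=
  {X | ∃ u : F3, IsRep3 ![u ^ 2 + j, u, 1] X}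

/-- The point `P₀ = [(1,0,0)]`. -/
def P₀ : PG2 := Projectivization.mk F3 ![1, 0, 0] (by decide)

/-- The quadratic form `y₀y₂ − y₁² − j·y₂²`. -/
def conicForm (j : F3) : QuadraticForm F3 (Fin 3 → F3) :=
  QuadraticMap.linMulLin (LinearMap.proj 0) (LinearMap.proj 2)
    - QuadraticMap.linMulLin (LinearMap.proj 1) (LinearMap.proj 1)
    - j • QuadraticMap.linMulLin (LinearMap.proj 2) (LinearMap.proj 2)

theorem conicForm_apply (j : F3) (y : Fin 3 → F3) :
    conicForm j y = y 0 * y 2 - y 1 ^ 2 - j * y 2 ^ 2 := by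
  simp [conicForm]
  ring

theorem polarBilin_conicForm_apply (j : F3) (x y : Fin 3 → F3) :
    (conicForm j).polarBilin x y =
      x 0 * y 2 + y 0 * x 2 - 2 * x 1 * y 1 - 2 * j * x 2 * y 2 := by
  simp only [QuadraticMap.polarBilin_apply_apply, QuadraticMap.polar, conicForm_apply,
    Pi.add_apply]
  ring

theorem eq_zero_of_polarBilin_conicForm_eq_zero {j : F3} {x : Fin 3 → F3}
    (h : ∀ y, (conicForm j).polarBilin x y = 0) : x = 0 := by
  have h0 := h ![1, 0, 0]
  have h1 := h ![0, 1, 0]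
  have h2 := h ![0, 0, 1]
  have two_ne : (2 : F3) ≠ 0 := by decide
  rw [polarBilin_conicForm_apply] at h0 h1 h2
  simp [two_ne] at h0 h1 h2
  simp only [h0, mul_zero, sub_zero] at h2
  ext i
  fin_cases i <;> simp [h0, h1, h2]

theorem mk_mem_Δ2_iff {j : F3} {v : Fin 3 → F3} (hv : v ≠ 0) :
    Projectivization.mk F3 v hv ∈ Δ2 j ↔ v 2 ≠ 0 ∧ conicForm j v = 0 := by
  rw [conicForm_apply]
  constructor
  · rintro ⟨u, hu, h⟩
    obtain ⟨a, rfl⟩ := (Projectivization.mk_eq_mk_iff' F3 _ _ hv hu).1 h.symm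
    refine ⟨fun ha => hv ?_, ?_⟩
    · have : a = 0 := by simpa using ha
      simp [this]
    · simp
      ring
  · rintro ⟨h2, h⟩
    refine ⟨v 1 / v 2, fun h => by simpa using congrFun h 2,
      (Projectivization.mk_eq_mk_iff' F3 _ _ _ hv).2 ⟨(v 2)⁻¹, ?_⟩⟩
    ext i
    fin_cases i <;> simp <;> field_simp
    linear_combination h

theorem mk_eq_P₀_iff {v : Fin 3 → F3} (hv : v ≠ 0) :
    Projectivization.mk F3 v hv = P₀ ↔ v 1 = 0 ∧ v 2 = 0 := by
  rw [P₀, Projectivization.mk_eq_mk_iff']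
  constructor
  · rintro ⟨a, rfl⟩
    simp
  · rintro ⟨h1, h2⟩
    refine ⟨v 0, ?_⟩
    ext i
    fin_cases i <;> simp [h1, h2]

theorem mk_mem_Δ2_union_P₀_iff {j : F3} {v : Fin 3 → F3} (hv : v ≠ 0) :
    Projectivization.mk F3 v hv ∈ Δ2 j ∪ {P₀} ↔ conicForm j v = 0 := by
  rw [Set.mem_union, mk_mem_Δ2_iff, Set.mem_singleton_iff, mk_eq_P₀_iff, conicForm_apply]
  by_cases h2 : v 2 = 0 <;> simp [h2]

theorem mk_mem_Δ2_add_one_iff {j : F3} {v : Fin 3 → F3} (hv : v ≠ 0) :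
    Projectivization.mk F3 v hv ∈ Δ2 (j + 1) ↔ conicForm j v = 1 := by
  rw [mk_mem_Δ2_iff, conicForm_apply, conicForm_apply]
  generalize v 0 = a, v 1 = b, v 2 = c
  revert j a b c
  decide

/-- A point of the conic conjugate to a given non-internal point. -/
theorem exists_isotropic_polarBilin_eq_zero {j : F3} {x : Fin 3 → F3} (hx : conicForm j x ≠ 1) :
    ∃ p : Fin 3 → F3, p ≠ 0 ∧ conicForm j p = 0 ∧ (conicForm j).polarBilin p x = 0 := by
  by_cases h2 : x 2 = 0
  · exact ⟨![1, 0, 0], by decide, by simp [conicForm_apply],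
      by rw [polarBilin_conicForm_apply]; simp [h2]⟩
  · obtain ⟨t, ht⟩ : ∃ t : F3, (t ^ 2 + j) * x 2 + x 0 - 2 * t * x 1 - 2 * j * x 2 = 0 := by
      rw [conicForm_apply] at hx
      generalize x 0 = a, x 1 = b, x 2 = c at hx h2 ⊢
      revert j a b c
      decide
    exact ⟨![t ^ 2 + j, t, 1], fun h => by simpa using congrFun h 2,
      by simp [conicForm_apply], by rw [polarBilin_conicForm_apply]; simpa using ht⟩

/-- The form has no totally isotropic plane. -/
theorem exists_smul_eq_of_isotropic {j : F3} {p v : Fin 3 → F3} (hp : p ≠ 0) (hv : v ≠ 0)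
    (hqp : conicForm j p = 0) (hqv : conicForm j v = 0)
    (hpv : (conicForm j).polarBilin p v = 0) : ∃ a : F3, a • p = v := by
  rw [← Projectivization.mk_eq_mk_iff' F3 v p hv hp]
  rw [conicForm_apply] at hqp hqv
  rw [polarBilin_conicForm_apply] at hpv
  have h12 : p 1 * v 2 - p 2 * v 1 = 0 := by
    apply pow_eq_zero_iff two_ne_zero |>.1
    linear_combination p 2 * v 2 * hpv - v 2 ^ 2 * hqp - p 2 ^ 2 * hqv
  by_cases hp2 : p 2 = 0
  · have hp1 : p 1 = 0 := by simpa [hp2] using hqp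
    have hp0 : p 0 ≠ 0 := fun h => hp (by ext i; fin_cases i <;> simp [*])
    have hv2 : v 2 = 0 := by simpa [hp2, hp1, hp0] using hpv
    have hv1 : v 1 = 0 := by simpa [hv2] using hqv
    rw [(mk_eq_P₀_iff hv).2 ⟨hv1, hv2⟩, (mk_eq_P₀_iff hp).2 ⟨hp1, hp2⟩]
  · rw [Projectivization.mk_eq_mk_iff']
    refine ⟨v 2 / p 2, ?_⟩
    ext i
    fin_cases i <;> simp <;> field_simp
    · apply mul_left_cancel₀ hp2
      linear_combination -p 2 * hpv + 2 * v 2 * hqp + 2 * p 1 * h12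
    · linear_combination h12

theorem isTangent2_polar {j : F3} {p : Fin 3 → F3} (hp : p ≠ 0) (hqp : conicForm j p = 0) :
    IsTangent2 {X | ∃ v, IsRep3 v X ∧ v ∈ ((conicForm j).polarBilin p).ker} (Δ2 j ∪ {P₀}) := by
  refine ⟨⟨_, ?_, rfl⟩, ?_⟩
  · have hne : (conicForm j).polarBilin p ≠ 0 := fun h =>
      hp (eq_zero_of_polarBilin_conicForm_eq_zero fun y => by rw [h]; rfl)
    have := Module.Dual.finrank_ker_add_one_of_ne_zero hne
    simpa using this
  · rw [Set.ncard_eq_one]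
    refine ⟨Projectivization.mk F3 p hp, Set.eq_singleton_iff_unique_mem.2 ⟨⟨⟨p, ⟨hp, rfl⟩, ?_⟩,
      (mk_mem_Δ2_union_P₀_iff hp).2 hqp⟩, ?_⟩⟩
    · rw [LinearMap.mem_ker, QuadraticMap.polarBilin_apply_apply, QuadraticMap.polar_self, hqp,
        smul_zero]
    · rintro _ ⟨⟨v, ⟨hv, rfl⟩, hpv⟩, hC⟩
      exact (Projectivization.mk_eq_mk_iff' F3 _ _ _ _).2
        (exists_smul_eq_of_isotropic hp hv hqp ((mk_mem_Δ2_union_P₀_iff hv).1 hC) hpv)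

theorem polarBilin_ne_zero_of_conicForm_eq_one {j : F3} {x p : Fin 3 → F3} (hp : p ≠ 0)
    (hqx : conicForm j x = 1) (hqp : conicForm j p = 0) :
    (conicForm j).polarBilin p x ≠ 0 := by
  intro h
  rw [conicForm_apply] at hqx hqp
  rw [polarBilin_conicForm_apply] at h
  have hsq : (p 1 * x 2 - p 2 * x 1) ^ 2 + p 2 ^ 2 = 0 := by
    linear_combination p 2 * x 2 * h - x 2 ^ 2 * hqp - p 2 ^ 2 * hqx
  have anisotropic : ∀ a b : F3, a ^ 2 + b ^ 2 = 0 → b = 0 := by decide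
  have hp2 := anisotropic _ _ hsq
  have hp1 : p 1 = 0 := by simpa [hp2] using hqp
  have hp0 : p 0 ≠ 0 := fun h => hp (by ext i; fin_cases i <;> simp [*])
  have hx2 : x 2 = 0 := by simpa [hp2, hp1, hp0] using h
  have : ∀ a : F3, -a ^ 2 ≠ 1 := by decide
  exact this (x 1) (by linear_combination hqx - (x 0 - j * x 2) * hx2)

/-- A line through a point with `q = 1` that meets the conic meets it again. -/
theorem not_isTangent2_of_conicForm_eq_one {j : F3} {x : Fin 3 → F3} (hx : x ≠ 0)
    (hqx : conicForm j x = 1) {L : Set PG2} (hL : IsTangent2 L (Δ2 j ∪ {P₀})) :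
    Projectivization.mk F3 x hx ∉ L := by
  obtain ⟨⟨W, -, rfl⟩, hcard⟩ := hL
  rintro ⟨x', ⟨hx', hxx'⟩, hx'W⟩
  obtain ⟨c, hc⟩ := (Projectivization.mk_eq_mk_iff' F3 _ _ _ _).1 hxx'.symm
  have hxW : x ∈ W := hc ▸ W.smul_mem c hx'W
  obtain ⟨_, hP⟩ := Set.ncard_eq_one.1 hcard
  obtain ⟨⟨⟨p, ⟨hp, rfl⟩, hpW⟩, hpC⟩, huniq⟩ := Set.eq_singleton_iff_unique_mem.1 hP
  have hqp := (mk_mem_Δ2_union_P₀_iff hp).1 hpC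
  have hB := polarBilin_ne_zero_of_conicForm_eq_one hp hqx hqp
  have not_mem_span : ∀ a : F3, a • p ≠ x := by
    rintro a rfl
    simp [QuadraticMap.map_smul, hqp] at hqx
  set s := -((conicForm j).polarBilin p x)⁻¹ with hs
  have hy : s • p + x ≠ 0 := fun h => not_mem_span (-s) (by
    rw [neg_smul, neg_eq_iff_add_eq_zero, h])
  have hqy : conicForm j (s • p + x) = 0 := by
    rw [QuadraticMap.map_add (conicForm j), QuadraticMap.map_smul, QuadraticMap.polar_smul_left, hqp, hqx,
      ← QuadraticMap.polarBilin_apply_apply, hs,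
      smul_zero, zero_add, smul_eq_mul, neg_mul, inv_mul_cancel₀ hB, add_neg_cancel]
  obtain ⟨a, ha⟩ := (Projectivization.mk_eq_mk_iff' F3 _ _ _ _).1 <|
    huniq (Projectivization.mk F3 _ hy) ⟨⟨_, ⟨hy, rfl⟩, W.add_mem (W.smul_mem s hpW) hxW⟩,
      (mk_mem_Δ2_union_P₀_iff hy).2 hqy⟩
  exact not_mem_span (a - s) (by rw [sub_smul, ha, add_sub_cancel_left])

/-- For each `j ∈ F`, the set `C_j := Δ_j ∪ {P₀}` is the set of
projective zeros of the quadratic form `q_j(y) = y₀y₂ − y₁² − j·y₂²`, whose polar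
bilinear form is nondegenerate, and the set of internal points of the conic `C_j`
equals `Δ_{j+1}`. -/
theorem Cj_is_conic_with_internal_points_Dj_succ :
    ∀ j : F3, ∃ q : QuadraticForm F3 (Fin 3 → F3),
      (∀ y : Fin 3 → F3, q y = y 0 * y 2 - y 1 ^ 2 - j * y 2 ^ 2) ∧
      (∀ x : Fin 3 → F3, (∀ y, q (x + y) - q x - q y = 0) → x = 0) ∧
      Δ2 j ∪ {P₀} = {X : PG2 | ∀ v, IsRep3 v X → q v = 0} ∧
      {X : PG2 | IsInternal2 X (Δ2 j ∪ {P₀})} = Δ2 (j + 1) := by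
  intro j
  refine ⟨conicForm j, conicForm_apply j, fun x h => eq_zero_of_polarBilin_conicForm_eq_zero h,
    ?_, ?_⟩
  · ext X
    induction X using Projectivization.ind with | h v hv
    refine ⟨?_, fun h => (mk_mem_Δ2_union_P₀_iff hv).2 (h v ⟨hv, rfl⟩)⟩
    rintro h w ⟨hw, hwv⟩
    exact (mk_mem_Δ2_union_P₀_iff hw).1 (hwv ▸ h)
  · ext X
    induction X using Projectivization.ind with | h x hx
    rw [mk_mem_Δ2_add_one_iff]
    refine ⟨fun h => ?_, fun h L hL => not_isTangent2_of_conicForm_eq_one hx h hL⟩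
    by_contra hqx
    obtain ⟨p, hp, hqp, hpx⟩ := exists_isotropic_polarBilin_eq_zero hqx
    exact h _ (isTangent2_polar hp hqp) ⟨x, ⟨hx, rfl⟩, hpx⟩
end
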